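/- Let μ be an M-invariant probability measure on [0,1/2]. For every z₀ ∈ [0,1/2], the flat chain (Z_n) started at Z₀ = z₀ satisfies the strong law of large numbers: for every continuous function f : [0,1/2] → ℝ, almost surely lim_{N→∞} (1/(N+1))·∑_{n=0}^{N} f(Z_n) = ∫ f dμ. -/

import Mathlib

open MeasureTheory ProbabilityTheory Filter Set

noncomputable section

/-- The six maps `z₁, …, z₆` of the flat-triangle iterated function system. -/
def zfun : Fin 6 → ℝ → ℝ :=
  ![ fun x => 3*x/(2+2*x),
     fun x => if x < 2/7 then 3*x/(2-x) else (2-4*x)/(2-x),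
     fun x => if x < 1/5 then (1+x)/(3-3*x) else (2-4*x)/(3-3*x),
     fun x => (1+x)/(4-2*x),
     fun x => (1-2*x)/(4-2*x),
     fun x => (1-2*x)/3 ]

/-- The flat-triangle Markov kernel `M`, as an operator on measures:
`ν ↦ (1/6)·∑ i, (z_i)_* ν`; its `n`-th iterate applied to `δ_x` is `M^n(x, ·)`. -/
def Mstep (ν : Measure ℝ) : Measure ℝ :=
  ∑ i : Fin 6, (6 : ENNReal)⁻¹ • ν.map (zfun i)

/-- A measure `μ` is `M`-invariant if `μ(B) = (1/6)·∑ i, μ(z_i⁻¹(B))` for every Borel `B`. -/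
def MInvariant (μ : Measure ℝ) : Prop :=
  ∀ B : Set ℝ, MeasurableSet B → μ B = (6 : ENNReal)⁻¹ * ∑ i : Fin 6, μ (zfun i ⁻¹' B)

variable {Ω : Type*}

/-- `ι` is an i.i.d. sequence of uniform `{1,…,6}`-valued random variables. -/
def IsIIDUniform [MeasurableSpace Ω] (P : Measure Ω) (ι : ℕ → Ω → Fin 6) : Prop :=
  (∀ n, Measurable (ι n)) ∧
  iIndepFun ι P ∧
  (∀ n (i : Fin 6), P {ω | ι n ω = i} = 1/6)

/-- The flat-triangle Markov chain driven by the choices `ι`. -/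
def flatChain (ι : ℕ → Ω → Fin 6) (z0 : ℝ) : ℕ → Ω → ℝ
  | 0 => fun _ => z0
  | n+1 => fun ω => zfun (ι (n+1) ω) (flatChain ι z0 n ω)


/-! ### Contraction estimate -/

/-- square roots of the absolute derivatives of the maps, up to the factor `√6` -/
def sfun : Fin 6 → ℝ → ℝ :=
  ![ fun x => 1/(2+2*x), fun x => 1/(2-x), fun x => 1/(3*(1-x)),
     fun x => 1/(4-2*x), fun x => 1/(4-2*x), fun _ => 1/3 ]

def vfun (x : ℝ) : ℝ := 5 + 2*x

/-- the weighted distance -/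
def Dfun (x y : ℝ) : ℝ := √|x - y| * (√(vfun x) * √(vfun y))

def Iset : Set ℝ := Set.Icc (0:ℝ) (1/2)

lemma zfun_mem (i : Fin 6) {x : ℝ} (hx : x ∈ Iset) : zfun i x ∈ Iset := by
  obtain ⟨h0, h1⟩ := hx
  have h2 : (0:ℝ) < 2 + 2*x := by linarith
  have h3 : (0:ℝ) < 2 - x := by linarith
  have h4 : (0:ℝ) < 3 - 3*x := by linarith
  have h5 : (0:ℝ) < 4 - 2*x := by linarith
  fin_cases i <;> simp only [zfun, Iset] <;> simp <;> (try split_ifs) <;>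
    constructor <;> first
      | (apply div_nonneg <;> linarith)
      | (rw [div_le_iff₀ (by linarith)]; linarith)

lemma sfun_pos (i : Fin 6) {x : ℝ} (hx : x ∈ Iset) : 0 < sfun i x := by
  obtain ⟨h0, h1⟩ := hx
  fin_cases i <;> simp [sfun] <;> linarith

lemma vfun_pos {x : ℝ} (hx : x ∈ Iset) : 0 < vfun x := by
  obtain ⟨h0, h1⟩ := hx
  simp only [vfun]; linarith

lemma fold_le {a b : ℝ} : |min a (1-a) - min b (1-b)| ≤ |a - b| := by
  rcases min_cases a (1-a) with ⟨h, h'⟩ | ⟨h, h'⟩ <;>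
  rcases min_cases b (1-b) with ⟨k, k'⟩ | ⟨k, k'⟩ <;> rw [h, k] <;>
  rcases abs_cases (a-b) with ⟨u, u'⟩ | ⟨u, u'⟩ <;> rw [u, abs_le] <;>
  constructor <;> linarith

lemma z2_eq {x : ℝ} (hx : x ∈ Iset) : zfun 1 x = min (3*x/(2-x)) (1 - 3*x/(2-x)) := by
  obtain ⟨h0, h1⟩ := hx
  have h3 : (0:ℝ) < 2 - x := by linarith
  have e : 1 - 3*x/(2-x) = (2-4*x)/(2-x) := by field_simp; ring
  rw [e]
  simp only [zfun]; simp
  split_ifs with h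
  · rw [min_eq_left]; gcongr; linarith
  · rw [min_eq_right]; gcongr; linarith

lemma z3_eq {x : ℝ} (hx : x ∈ Iset) :
    zfun 2 x = min ((1+x)/(3-3*x)) (1 - (1+x)/(3-3*x)) := by
  obtain ⟨h0, h1⟩ := hx
  have h3 : (0:ℝ) < 3 - 3*x := by linarith
  have e : 1 - (1+x)/(3-3*x) = (2-4*x)/(3-3*x) := by
    rw [eq_div_iff h3.ne', sub_mul, div_mul_cancel₀ _ h3.ne']; ring
  rw [e]
  simp only [zfun]; simp
  split_ifs with h
  · rw [min_eq_left]; gcongr; linarith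
  · rw [min_eq_right]; gcongr; linarith

lemma abs_eq_of {a b c : ℝ} (hb : 0 ≤ b) (h : a = b * c ∨ a = -(b * c)) : |a| = b * |c| := by
  rcases h with h | h <;> rw [h] <;> simp [abs_mul, abs_of_nonneg hb]

lemma zfun_diff (i : Fin 6) {x y : ℝ} (hx : x ∈ Iset) (hy : y ∈ Iset) :
    |zfun i x - zfun i y| ≤ 6 * (sfun i x * sfun i y) * |x - y| := by
  have hs : 0 ≤ 6 * (sfun i x * sfun i y) := by
    have := sfun_pos i hx; have := sfun_pos i hy; positivity
  have hx' := hx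
  have hy' := hy
  obtain ⟨h0, h1⟩ := hx'
  obtain ⟨g0, g1⟩ := hy'
  have a2 : (2 + 2*x) ≠ 0 := by linarith
  have a3 : (2 - x) ≠ 0 := by linarith
  have a4 : (1 - x) ≠ 0 := by linarith
  have a5 : (4 - 2*x) ≠ 0 := by linarith
  have b2 : (2 + 2*y) ≠ 0 := by linarith
  have b3 : (2 - y) ≠ 0 := by linarith
  have b4 : (1 - y) ≠ 0 := by linarith
  have b5 : (4 - 2*y) ≠ 0 := by linarith
  have c1 : (3 - 3*x) = 3*(1-x) := by ring
  have c2 : (3 - 3*y) = 3*(1-y) := by ring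
  fin_cases i
  · refine (abs_eq_of hs (Or.inl ?_)).le
    simp [zfun, sfun]
    rw [div_sub_div _ _ a2 b2]; field_simp; ring
  · change |zfun 1 x - zfun 1 y| ≤ _
    rw [z2_eq hx, z2_eq hy]
    refine fold_le.trans (abs_eq_of hs (Or.inl ?_)).le
    simp [sfun]
    rw [div_sub_div _ _ a3 b3]; field_simp; ring
  · change |zfun 2 x - zfun 2 y| ≤ _
    rw [z3_eq hx, z3_eq hy]
    refine fold_le.trans (abs_eq_of hs (Or.inl ?_)).le
    simp only [c1, c2]
    simp [sfun]
    field_simp; ring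
  · refine (abs_eq_of hs (Or.inl ?_)).le
    simp [zfun, sfun]
    rw [div_sub_div _ _ a5 b5]; field_simp; ring
  · refine (abs_eq_of hs (Or.inr ?_)).le
    simp [zfun, sfun]
    rw [div_sub_div _ _ a5 b5]; field_simp; ring
  · refine (abs_eq_of hs (Or.inr ?_)).le
    simp [zfun, sfun]
    ring

lemma diag_aux0 {x : ℝ} (h0 : 0 ≤ x) (h1 : x ≤ 1/5) :
    (5+8*x)/(2*(1+x)^2) + (10+(1)*x)/(2-x)^2 + (17+(-13)*x)/(9*(1-x)^2) + 11/(2*(2-x)) + (17-4*x)/9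
      ≤ 2.44 * (5+2*x) := by
  have a : (0:ℝ) < 1 + x := by linarith
  have b : (0:ℝ) < 2 - x := by linarith
  have c : (0:ℝ) < 1 - x := by linarith
  have u : (0:ℝ) ≤ x - 0 := by linarith
  have w : (0:ℝ) ≤ 1/5 - x := by linarith
  have key : 2.44 * (5+2*x) - ((5+8*x)/(2*(1+x)^2) + (10+(1)*x)/(2-x)^2 + (17+(-13)*x)/(9*(1-x)^2)
      + 11/(2*(2-x)) + (17-4*x)/9) =
      (1890625/9*((x-0)^0*(1/5-x)^7) +
      8520625/6*((x-0)^1*(1/5-x)^6) +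
      72585125/18*((x-0)^2*(1/5-x)^5) +
      18637700/3*((x-0)^3*(1/5-x)^4) +
      11164435/2*((x-0)^4*(1/5-x)^3) +
      5811003/2*((x-0)^5*(1/5-x)^2) +
      4010832/5*((x-0)^6*(1/5-x)^1) +
      2219832/25*((x-0)^7*(1/5-x)^0)) / ((1+x)^2*(2-x)^2*(1-x)^2) := by
    field_simp
    ring
  have : 0 ≤ (1890625/9*((x-0)^0*(1/5-x)^7) +
      8520625/6*((x-0)^1*(1/5-x)^6) +
      72585125/18*((x-0)^2*(1/5-x)^5) +
      18637700/3*((x-0)^3*(1/5-x)^4) +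
      11164435/2*((x-0)^4*(1/5-x)^3) +
      5811003/2*((x-0)^5*(1/5-x)^2) +
      4010832/5*((x-0)^6*(1/5-x)^1) +
      2219832/25*((x-0)^7*(1/5-x)^0)) / ((1+x)^2*(2-x)^2*(1-x)^2) := by positivity
  linarith

lemma diag_aux1 {x : ℝ} (h0 : 1/5 ≤ x) (h1 : x ≤ 2/7) :
    (5+8*x)/(2*(1+x)^2) + (10+(1)*x)/(2-x)^2 + (19+(-23)*x)/(9*(1-x)^2) + 11/(2*(2-x)) + (17-4*x)/9
      ≤ 2.44 * (5+2*x) := by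
  have a : (0:ℝ) < 1 + x := by linarith
  have b : (0:ℝ) < 2 - x := by linarith
  have c : (0:ℝ) < 1 - x := by linarith
  have u : (0:ℝ) ≤ x - 1/5 := by linarith
  have w : (0:ℝ) ≤ 2/7 - x := by linarith
  have key : 2.44 * (5+2*x) - ((5+8*x)/(2*(1+x)^2) + (10+(1)*x)/(2-x)^2 + (19+(-23)*x)/(9*(1-x)^2)
      + 11/(2*(2-x)) + (17-4*x)/9) =
      (67708411288/2025*((x-1/5)^0*(2/7-x)^7) +
      88280986024/405*((x-1/5)^1*(2/7-x)^6) +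
      10860565751/18*((x-1/5)^2*(2/7-x)^5) +
      148708612115/162*((x-1/5)^3*(2/7-x)^4) +
      22342334000/27*((x-1/5)^4*(2/7-x)^3) +
      23808224125/54*((x-1/5)^5*(2/7-x)^2) +
      256221875/2*((x-1/5)^6*(2/7-x)^1) +
      1262031250/81*((x-1/5)^7*(2/7-x)^0)) / ((1+x)^2*(2-x)^2*(1-x)^2) := by
    field_simp
    ring
  have : 0 ≤ (67708411288/2025*((x-1/5)^0*(2/7-x)^7) +
      88280986024/405*((x-1/5)^1*(2/7-x)^6) +
      10860565751/18*((x-1/5)^2*(2/7-x)^5) +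
      148708612115/162*((x-1/5)^3*(2/7-x)^4) +
      22342334000/27*((x-1/5)^4*(2/7-x)^3) +
      23808224125/54*((x-1/5)^5*(2/7-x)^2) +
      256221875/2*((x-1/5)^6*(2/7-x)^1) +
      1262031250/81*((x-1/5)^7*(2/7-x)^0)) / ((1+x)^2*(2-x)^2*(1-x)^2) := by positivity
  linarith

lemma diag_aux2 {x : ℝ} (h0 : 2/7 ≤ x) (h1 : x ≤ 1/2) :
    (5+8*x)/(2*(1+x)^2) + (14+(-13)*x)/(2-x)^2 + (19+(-23)*x)/(9*(1-x)^2) + 11/(2*(2-x)) + (17-4*x)/9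
      ≤ 2.44 * (5+2*x) := by
  have a : (0:ℝ) < 1 + x := by linarith
  have b : (0:ℝ) < 2 - x := by linarith
  have c : (0:ℝ) < 1 - x := by linarith
  have u : (0:ℝ) ≤ x - 2/7 := by linarith
  have w : (0:ℝ) ≤ 1/2 - x := by linarith
  have key : 2.44 * (5+2*x) - ((5+8*x)/(2*(1+x)^2) + (14+(-13)*x)/(2-x)^2 + (19+(-23)*x)/(9*(1-x)^2)
      + 11/(2*(2-x)) + (17-4*x)/9) =
      (2067712/81*((x-2/7)^0*(1/2-x)^7) +
      90166048/405*((x-2/7)^1*(1/2-x)^6) +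
      513854768/675*((x-2/7)^2*(1/2-x)^5) +
      61487552/45*((x-2/7)^3*(1/2-x)^4) +
      2864421812/2025*((x-2/7)^4*(1/2-x)^3) +
      576446486/675*((x-2/7)^5*(1/2-x)^2) +
      568479968/2025*((x-2/7)^6*(1/2-x)^1) +
      26353376/675*((x-2/7)^7*(1/2-x)^0)) / ((1+x)^2*(2-x)^2*(1-x)^2) := by
    field_simp
    ring
  have : 0 ≤ (2067712/81*((x-2/7)^0*(1/2-x)^7) +
      90166048/405*((x-2/7)^1*(1/2-x)^6) +
      513854768/675*((x-2/7)^2*(1/2-x)^5) +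
      61487552/45*((x-2/7)^3*(1/2-x)^4) +
      2864421812/2025*((x-2/7)^4*(1/2-x)^3) +
      576446486/675*((x-2/7)^5*(1/2-x)^2) +
      568479968/2025*((x-2/7)^6*(1/2-x)^1) +
      26353376/675*((x-2/7)^7*(1/2-x)^0)) / ((1+x)^2*(2-x)^2*(1-x)^2) := by positivity
  linarith

lemma diag_ineq {x : ℝ} (hx : x ∈ Iset) :
    ∑ i, sfun i x * vfun (zfun i x) ≤ 2.44 * vfun x := by
  obtain ⟨h0, h1⟩ := hx
  have a : (0:ℝ) < 1 + x := by linarith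
  have b : (0:ℝ) < 2 - x := by linarith
  have c : (0:ℝ) < 1 - x := by linarith
  have e1 : (2 + 2*x) = 2*(1+x) := by ring
  have e2 : (4 - 2*x) = 2*(2-x) := by ring
  have e3 : (3 - 3*x) = 3*(1-x) := by ring
  have e4 : ¬ (7:ℝ) = 0 := by norm_num
  simp only [Fin.sum_univ_six, sfun, zfun, vfun]
  simp only [Matrix.cons_val, e1, e2, e3]
  by_cases k1 : x < 1/5
  · have k2 : x < 2/7 := by linarith
    simp only [k1, k2, if_true]
    refine le_of_eq_of_le ?_ (diag_aux0 h0 k1.le)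
    field_simp
    ring
  · by_cases k2 : x < 2/7
    · simp only [k1, k2, if_true, if_false]
      push Not at k1
      refine le_of_eq_of_le ?_ (diag_aux1 k1 k2.le)
      field_simp
      ring
    · simp only [k1, k2, if_false]
      push Not at k2
      refine le_of_eq_of_le ?_ (diag_aux2 k2 h1)
      field_simp
      ring

lemma D_contract {x y : ℝ} (hx : x ∈ Iset) (hy : y ∈ Iset) :
    (∑ i, Dfun (zfun i x) (zfun i y)) / 6 ≤ 0.999 * Dfun x y := by
  have key : ∀ i, Dfun (zfun i x) (zfun i y) ≤
      (√6 * √|x-y|) * (√(sfun i x * vfun (zfun i x)) * √(sfun i y * vfun (zfun i y))) := by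
    intro i
    have s1 := (sfun_pos i hx).le
    have s2 := (sfun_pos i hy).le
    have := Real.sqrt_le_sqrt (zfun_diff i hx hy)
    rw [Real.sqrt_mul (by positivity), Real.sqrt_mul (by positivity), Real.sqrt_mul s1] at this
    rw [Real.sqrt_mul s1, Real.sqrt_mul s2]
    unfold Dfun
    calc _ ≤ (√6 * (√(sfun i x) * √(sfun i y)) * √|x - y|) *
            (√(vfun (zfun i x)) * √(vfun (zfun i y))) := by gcongr
      _ = _ := by ring
  have cs := Real.sum_sqrt_mul_sqrt_le (s := Finset.univ)
    (f := fun i => sfun i x * vfun (zfun i x)) (g := fun i => sfun i y * vfun (zfun i y))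
    (fun i => (mul_pos (sfun_pos i hx) (vfun_pos (zfun_mem i hx))).le)
    (fun i => (mul_pos (sfun_pos i hy) (vfun_pos (zfun_mem i hy))).le)
  have d1 := Real.sqrt_le_sqrt (diag_ineq hx)
  have d2 := Real.sqrt_le_sqrt (diag_ineq hy)
  rw [Real.sqrt_mul (by norm_num)] at d1 d2
  have h6 : √6 ≤ 2.45 := by
    rw [Real.sqrt_le_left (by norm_num)]; norm_num
  have hD : 0 ≤ Dfun x y := by unfold Dfun; positivity
  have : ∑ i, Dfun (zfun i x) (zfun i y) ≤ √6 * 2.44 * Dfun x y := by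
    calc _ ≤ ∑ i, (√6 * √|x-y|) *
          (√(sfun i x * vfun (zfun i x)) * √(sfun i y * vfun (zfun i y))) :=
          Finset.sum_le_sum fun i _ => key i
      _ = (√6 * √|x-y|) * ∑ i,
          (√(sfun i x * vfun (zfun i x)) * √(sfun i y * vfun (zfun i y))) := by
          rw [Finset.mul_sum]
      _ ≤ (√6 * √|x-y|) * ((√2.44 * √(vfun x)) * (√2.44 * √(vfun y))) := by
          refine mul_le_mul_of_nonneg_left (cs.trans ?_) (by positivity)
          gcongr
      _ = √6 * (√2.44 * √2.44) * Dfun x y := by unfold Dfun; ring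
      _ = _ := by rw [Real.mul_self_sqrt (by norm_num)]
  nlinarith

/-! ### The transfer operator -/

def Tavg (G : ℝ → ℝ) (x : ℝ) : ℝ := (∑ i, G (zfun i x)) / 6

lemma zfun_meas (i : Fin 6) : Measurable (zfun i) := by
  fin_cases i <;> simp only [zfun] <;> simp
  · fun_prop
  · refine Measurable.ite measurableSet_Iio ?_ ?_ <;> fun_prop
  · refine Measurable.ite measurableSet_Iio ?_ ?_ <;> fun_prop
  · fun_prop
  · fun_prop
  · fun_prop

lemma Tavg_meas {G : ℝ → ℝ} (hG : Measurable G) : Measurable (Tavg G) := by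
  unfold Tavg
  have := zfun_meas
  exact (Finset.measurable_sum _ fun i _ => hG.comp (this i)).div_const _

lemma Tavg_bdd {G : ℝ → ℝ} {B : ℝ} (hG : ∀ x, |G x| ≤ B) (x : ℝ) : |Tavg G x| ≤ B := by
  unfold Tavg
  rw [abs_div, abs_of_pos (by norm_num : (0:ℝ) < 6), div_le_iff₀ (by norm_num)]
  refine (Finset.abs_sum_le_sum_abs _ _).trans ?_
  refine (Finset.sum_le_sum fun i _ => hG (zfun i x)).trans ?_
  simp; linarith

lemma Tavg_mod {G : ℝ → ℝ} {ε L : ℝ} (hL : 0 ≤ L)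
    (hG : ∀ x ∈ Iset, ∀ y ∈ Iset, |G x - G y| ≤ ε + L * Dfun x y) :
    ∀ x ∈ Iset, ∀ y ∈ Iset, |Tavg G x - Tavg G y| ≤ ε + (L * 0.999) * Dfun x y := by
  intro x hx y hy
  have e : Tavg G x - Tavg G y = (∑ i, (G (zfun i x) - G (zfun i y))) / 6 := by
    unfold Tavg; rw [Finset.sum_sub_distrib]; ring
  rw [e, abs_div, abs_of_pos (by norm_num : (0:ℝ) < 6), div_le_iff₀ (by norm_num)]
  refine (Finset.abs_sum_le_sum_abs _ _).trans ?_
  refine (Finset.sum_le_sum fun i _ => hG _ (zfun_mem i hx) _ (zfun_mem i hy)).trans ?_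
  rw [Finset.sum_add_distrib, ← Finset.mul_sum]
  have := mul_le_mul_of_nonneg_left (D_contract hx hy) hL
  simp
  linarith

lemma iter_meas {G : ℝ → ℝ} (hG : Measurable G) (n : ℕ) : Measurable (Tavg^[n] G) := by
  induction n with
  | zero => simpa
  | succ n ih => rw [Function.iterate_succ_apply']; exact Tavg_meas ih

lemma iter_bdd {G : ℝ → ℝ} {B : ℝ} (hG : ∀ x, |G x| ≤ B) (n : ℕ) :
    ∀ x, |Tavg^[n] G x| ≤ B := by
  induction n with
  | zero => simpa
  | succ n ih => rw [Function.iterate_succ_apply']; exact Tavg_bdd ih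

lemma iter_mod {G : ℝ → ℝ} {ε L : ℝ} (hL : 0 ≤ L)
    (hG : ∀ x ∈ Iset, ∀ y ∈ Iset, |G x - G y| ≤ ε + L * Dfun x y) (n : ℕ) :
    ∀ x ∈ Iset, ∀ y ∈ Iset,
      |Tavg^[n] G x - Tavg^[n] G y| ≤ ε + (L * 0.999^n) * Dfun x y := by
  induction n with
  | zero => simpa
  | succ n ih =>
    rw [Function.iterate_succ_apply', pow_succ, ← mul_assoc]
    exact Tavg_mod (by positivity) ih

lemma D_le {x y : ℝ} (hx : x ∈ Iset) (hy : y ∈ Iset) : Dfun x y ≤ 6 := by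
  obtain ⟨h0, h1⟩ := hx
  obtain ⟨g0, g1⟩ := hy
  unfold Dfun
  have h6 : (0:ℝ) ≤ 6 := by norm_num
  rw [← Real.sqrt_mul (by simp only [vfun]; linarith), ← Real.sqrt_mul (abs_nonneg _)]
  rw [Real.sqrt_le_left (by norm_num)]
  have : |x - y| ≤ 1 := by rw [abs_le]; constructor <;> linarith
  have h2 : vfun x * vfun y ≤ 6 * 6 := by
    simp only [vfun]; apply mul_le_mul <;> linarith
  have h3 : 0 ≤ vfun x * vfun y := by
    simp only [vfun]; apply mul_nonneg <;> linarith
  nlinarith [abs_nonneg (x-y)]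

lemma le_D {x y : ℝ} (hx : x ∈ Iset) (hy : y ∈ Iset) : |x - y| ≤ Dfun x y := by
  obtain ⟨h0, h1⟩ := hx
  obtain ⟨g0, g1⟩ := hy
  unfold Dfun
  rw [← Real.sqrt_mul (by simp only [vfun]; linarith), ← Real.sqrt_mul (abs_nonneg _)]
  apply Real.le_sqrt_of_sq_le
  have : |x - y| ≤ 1 := by rw [abs_le]; constructor <;> linarith
  have h2 : 1 ≤ vfun x * vfun y := by
    simp only [vfun]; nlinarith
  nlinarith [abs_nonneg (x-y)]

lemma exists_mod {f : ℝ → ℝ} (hf : ContinuousOn f Iset) {ε : ℝ} (hε : 0 < ε) :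
    ∃ L, 0 ≤ L ∧ ∀ x ∈ Iset, ∀ y ∈ Iset, |f x - f y| ≤ ε + L * Dfun x y := by
  have hc : IsCompact Iset := isCompact_Icc
  obtain ⟨B, hB⟩ := hc.exists_bound_of_continuousOn hf
  have hu := hc.uniformContinuousOn_of_continuous hf
  rw [Metric.uniformContinuousOn_iff] at hu
  obtain ⟨δ, hδ, h⟩ := hu ε hε
  have hB0 : 0 ≤ B := (norm_nonneg _).trans (hB 0 (by simp [Iset]))
  refine ⟨2 * B / δ, by positivity, fun x hx y hy => ?_⟩
  have hD := le_D hx hy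
  have hD0 : 0 ≤ Dfun x y := (abs_nonneg _).trans hD
  by_cases hxy : |x - y| < δ
  · have := h x hx y hy hxy
    rw [Real.dist_eq] at this
    have : 0 ≤ 2 * B / δ * Dfun x y := by positivity
    linarith
  · have h1 := hB x hx
    have h2 := hB y hy
    rw [Real.norm_eq_abs] at h1 h2
    have h3 : |f x - f y| ≤ 2 * B := (abs_sub _ _).trans (by linarith)
    have h4 : 2 * B ≤ 2 * B / δ * Dfun x y := by
      rw [div_mul_eq_mul_div, le_div_iff₀ hδ]
      push Not at hxy
      exact mul_le_mul_of_nonneg_left (hxy.trans hD) (by linarith)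
    linarith

lemma integrable_bdd {μ : Measure ℝ} [IsProbabilityMeasure μ] {G : ℝ → ℝ} {B : ℝ}
    (hG : Measurable G) (hB : ∀ x, |G x| ≤ B) : Integrable G μ :=
  Integrable.of_bound hG.aestronglyMeasurable B (Eventually.of_forall hB)

lemma inv_map {μ : Measure ℝ} (hinv : MInvariant μ) : μ = Mstep μ := by
  ext B hB
  rw [hinv B hB, Mstep]
  simp only [Measure.finsetSum_apply, Measure.smul_apply, smul_eq_mul]
  rw [Finset.mul_sum]
  refine Finset.sum_congr rfl fun i _ => ?_
  rw [Measure.map_apply (zfun_meas i) hB]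

lemma int_Tavg {μ : Measure ℝ} [IsProbabilityMeasure μ] (hinv : MInvariant μ)
    {G : ℝ → ℝ} {B : ℝ} (hG : Measurable G) (hB : ∀ x, |G x| ≤ B) :
    ∫ x, Tavg G x ∂μ = ∫ x, G x ∂μ := by
  have hi : ∀ i, Integrable (fun x => G (zfun i x)) μ := fun i =>
    integrable_bdd (hG.comp (zfun_meas i)) (fun x => hB _)
  have hi' : ∀ i, Integrable G (μ.map (zfun i)) := fun i =>
    (integrable_map_measure hG.aestronglyMeasurable (zfun_meas i).aemeasurable).2 (hi i)
  conv_rhs => rw [inv_map hinv, Mstep]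
  rw [integral_finsetSum_measure (fun i _ => (hi' i).smul_measure (by simp))]
  unfold Tavg
  rw [integral_div, integral_finsetSum _ (fun i _ => hi i), Finset.sum_div]
  refine Finset.sum_congr rfl fun i _ => ?_
  rw [integral_smul_measure, integral_map (zfun_meas i).aemeasurable hG.aestronglyMeasurable]
  simp
  ring

lemma int_iter {μ : Measure ℝ} [IsProbabilityMeasure μ] (hinv : MInvariant μ)
    {G : ℝ → ℝ} {B : ℝ} (hG : Measurable G) (hB : ∀ x, |G x| ≤ B) (n : ℕ) :
    ∫ x, Tavg^[n] G x ∂μ = ∫ x, G x ∂μ := by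
  induction n with
  | zero => simp
  | succ n ih =>
    rw [Function.iterate_succ_apply', int_Tavg hinv (iter_meas hG n) (iter_bdd hB n), ih]

/-- uniform convergence of the iterates -/
lemma iter_conv {μ : Measure ℝ} [IsProbabilityMeasure μ] (hμI : μ Iset = 1)
    (hinv : MInvariant μ) {G : ℝ → ℝ} {B : ℝ} (hG : Measurable G) (hB : ∀ x, |G x| ≤ B)
    (hc : ContinuousOn G Iset) {ε : ℝ} (hε : 0 < ε) :
    ∃ K, ∀ x ∈ Iset, Tavg^[K] G x ≤ ∫ y, G y ∂μ + ε := by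
  obtain ⟨L, hL, hmod⟩ := exists_mod hc (half_pos hε)
  have ht : Tendsto (fun n : ℕ => L * 0.999^n * 6) atTop (nhds (L * 0 * 6)) :=
    ((tendsto_pow_atTop_nhds_zero_of_lt_one (by norm_num) (by norm_num)).const_mul L).mul_const 6
  rw [mul_zero, zero_mul] at ht
  obtain ⟨K, hK⟩ := (ht.eventually (gt_mem_nhds (half_pos hε))).exists
  refine ⟨K, fun x hx => ?_⟩
  have hae : ∀ᵐ y ∂μ, y ∈ Iset := by
    have hm : MeasurableSet Iset := measurableSet_Icc
    exact (prob_compl_eq_zero_iff hm).2 hμI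
  rw [← int_iter hinv hG hB K]
  have hI := integrable_bdd (μ := μ) (iter_meas hG K) (iter_bdd hB K)
  have : ∫ y, (Tavg^[K] G x - ε) ∂μ ≤ ∫ y, Tavg^[K] G y ∂μ := by
    refine integral_mono_ae (integrable_const _) hI ?_
    filter_upwards [hae] with y hy
    have h1 := iter_mod hL hmod K x hx y hy
    have h2 : (L * 0.999^K) * Dfun x y ≤ (L * 0.999^K) * 6 :=
      mul_le_mul_of_nonneg_left (D_le hx hy) (by positivity)
    have h3 := le_abs_self (Tavg^[K] G x - Tavg^[K] G y)
    linarith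
  simp at this
  linarith

/-! ### Martingale part -/

lemma meas_comp2 {m : MeasurableSpace Ω} {α β γ : Type*} [MeasurableSpace α] [MeasurableSpace β]
    [MeasurableSpace γ] {g : α × β → γ} (hg : Measurable g) {a : Ω → α} {b : Ω → β}
    (ha : Measurable[m] a) (hb : Measurable[m] b) : Measurable[m] (fun ω => g (a ω, b ω)) :=
  hg.comp (ha.prodMk hb)

lemma meas_sub' {m : MeasurableSpace Ω} {a b : Ω → ℝ}
    (ha : Measurable[m] a) (hb : Measurable[m] b) : Measurable[m] (fun ω => a ω - b ω) :=
  ha.sub hb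

@[reducible]
def histM (ι : ℕ → Ω → Fin 6) (n : ℕ) : MeasurableSpace Ω :=
  ⨆ j ∈ Set.Iic n, MeasurableSpace.comap (ι j) ⊤

lemma histM_mono (ι : ℕ → Ω → Fin 6) {m n : ℕ} (h : m ≤ n) : histM ι m ≤ histM ι n :=
  biSup_mono fun _ hj => le_trans hj h

lemma histM_le [mΩ : MeasurableSpace Ω] {ι : ℕ → Ω → Fin 6} (h : ∀ n, Measurable (ι n)) (n : ℕ) :
    histM ι n ≤ mΩ :=
  iSup₂_le fun j _ => (h j).comap_le

lemma iota_meas (ι : ℕ → Ω → Fin 6) (n : ℕ) : Measurable[histM ι n] (ι n) := by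
  have : MeasurableSpace.comap (ι n) ⊤ ≤ histM ι n :=
    le_iSup₂_of_le (f := fun j (_ : j ∈ Set.Iic n) => MeasurableSpace.comap (ι j) ⊤) n
      (le_refl n) le_rfl
  exact Measurable.of_comap_le this

lemma chain_meas (ι : ℕ → Ω → Fin 6) (z0 : ℝ) (n : ℕ) :
    Measurable[histM ι n] (flatChain ι z0 n) := by
  induction n with
  | zero => exact @measurable_const _ _ _ (histM ι 0) _
  | succ n ih =>
    have h1 : Measurable[histM ι (n+1)] (flatChain ι z0 n) :=
      ih.mono (histM_mono ι (Nat.le_succ n)) le_rfl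
    have h2 := iota_meas ι (n+1)
    have h3 : Measurable (fun p : Fin 6 × ℝ => zfun p.1 p.2) :=
      measurable_from_prod_countable_right fun i => zfun_meas i
    exact meas_comp2 (m := histM ι (n+1)) h3 h2 h1

lemma chain_mem (ι : ℕ → Ω → Fin 6) {z0 : ℝ} (hz : z0 ∈ Iset) (n : ℕ) (ω : Ω) :
    flatChain ι z0 n ω ∈ Iset := by
  induction n with
  | zero => exact hz
  | succ n ih => exact zfun_mem _ ih

lemma step_lintegral [MeasurableSpace Ω] {P : Measure Ω} [IsProbabilityMeasure P]
    {ι : ℕ → Ω → Fin 6} (hι : IsIIDUniform P ι) (n : ℕ) (Y : Fin 6 → Ω → ENNReal)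
    (hY : ∀ i, Measurable[histM ι n] (Y i)) :
    ∫⁻ ω, Y (ι (n+1) ω) ω ∂P = ∫⁻ ω, ∑ i, Y i ω * (1/6) ∂P := by
  obtain ⟨hm, hind, hu⟩ := hι
  have hle := histM_le hm n
  have e : ∀ ω, Y (ι (n+1) ω) ω =
      ∑ i, Y i ω * ({ω | ι (n+1) ω = i} : Set Ω).indicator (fun _ => (1:ENNReal)) ω := by
    intro ω
    simp [Set.indicator_apply]
  have hset : ∀ i, MeasurableSet {ω | ι (n+1) ω = i} := fun i =>
    hm (n+1) (measurableSet_singleton i)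
  have hY' : ∀ i, Measurable (Y i) := fun i => (hY i).mono hle le_rfl
  simp_rw [e]
  have q1 : ∀ i, Measurable fun ω => Y i ω *
      ({ω | ι (n+1) ω = i} : Set Ω).indicator (fun _ => (1:ENNReal)) ω := fun i =>
    (hY' i).mul (measurable_const.indicator (hset i))
  have q2 : ∀ i, Measurable fun ω => Y i ω * (1/6) := fun i => (hY' i).mul measurable_const
  rw [lintegral_finsetSum _ (fun i _ => q1 i), lintegral_finsetSum _ (fun i _ => q2 i)]
  refine Finset.sum_congr rfl fun i _ => ?_
  have hI : Indep (histM ι n) (⨆ j ∈ ({n+1} : Set ℕ), MeasurableSpace.comap (ι j) ⊤) P := by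
    refine indep_iSup_of_disjoint (fun j => (hm j).comap_le) hind ?_
    rw [Set.disjoint_singleton_right]
    simp
  rw [lintegral_mul_eq_lintegral_mul_lintegral_of_independent_measurableSpace hle
    (iSup₂_le fun j _ => (hm j).comap_le) hI (hY i), lintegral_indicator_const (hset i), one_mul, hu,
    lintegral_mul_const _ (hY' i)]
  have hs : MeasurableSet[⨆ j ∈ ({n+1} : Set ℕ), MeasurableSpace.comap (ι j) ⊤]
      {ω | ι (n+1) ω = i} := by
    have hle1 : MeasurableSpace.comap (ι (n+1)) ⊤ ≤
        ⨆ j ∈ ({n+1} : Set ℕ), MeasurableSpace.comap (ι j) ⊤ :=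
      le_iSup₂_of_le (f := fun j (_ : j ∈ ({n+1} : Set ℕ)) => MeasurableSpace.comap (ι j) ⊤)
        (n+1) rfl le_rfl
    exact hle1 _ ⟨{i}, trivial, rfl⟩
  exact Measurable.indicator (@measurable_const _ _ _
    (⨆ j ∈ ({n+1} : Set ℕ), MeasurableSpace.comap (ι j) ⊤) _) hs

/-- the martingale -/
def Smart (h : ℝ → ℝ) (ι : ℕ → Ω → Fin 6) (z0 : ℝ) (N : ℕ) (ω : Ω) : ℝ :=
  ∑ n ∈ Finset.range N, (h (flatChain ι z0 (n+1) ω) - Tavg h (flatChain ι z0 n ω))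

lemma Smart_meas {h : ℝ → ℝ} (hh : Measurable h) (ι : ℕ → Ω → Fin 6) (z0 : ℝ) (N : ℕ) :
    Measurable[histM ι N] (Smart h ι z0 N) := by
  unfold Smart
  refine @Finset.measurable_sum _ _ _ _ _ _ (histM ι N) _ _ fun n hn => ?_
  have hn' := Finset.mem_range.1 hn
  have h1 := (chain_meas ι z0 (n+1)).mono (histM_mono ι (show n+1 ≤ N from hn')) le_rfl
  have h2 := (chain_meas ι z0 n).mono (histM_mono ι hn'.le) le_rfl
  exact meas_sub' (m := histM ι N) (hh.comp h1) ((Tavg_meas hh).comp h2)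

lemma exp_avg {h : ℝ → ℝ} {H l : ℝ} (hH : ∀ x, |h x| ≤ H) (hl : 0 ≤ l) (hlH : 2 * l * H ≤ 1)
    (x : ℝ) :
    (∑ i, Real.exp (l * (h (zfun i x) - Tavg h x))) / 6 ≤ 1 + 4 * l^2 * H^2 := by
  have hH0 : 0 ≤ H := (abs_nonneg _).trans (hH 0)
  have hb : ∀ i, |l * (h (zfun i x) - Tavg h x)| ≤ 2 * l * H := by
    intro i
    rw [abs_mul, abs_of_nonneg hl]
    have := (abs_sub (h (zfun i x)) (Tavg h x)).trans (add_le_add (hH _) (Tavg_bdd hH x))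
    nlinarith
  have he : ∀ i, Real.exp (l * (h (zfun i x) - Tavg h x)) ≤
      1 + l * (h (zfun i x) - Tavg h x) + 4 * l^2 * H^2 := by
    intro i
    have h1 := Real.abs_exp_sub_one_sub_id_le ((hb i).trans hlH)
    have h2 := (abs_le.1 h1).2
    have h3 : (l * (h (zfun i x) - Tavg h x))^2 ≤ (2 * l * H)^2 := by
      rw [← sq_abs]
      exact pow_le_pow_left₀ (abs_nonneg _) (hb i) 2
    nlinarith
  have hs := Finset.sum_le_sum (s := Finset.univ) fun i _ => he i
  have hT : Tavg h x * 6 = ∑ i, h (zfun i x) := by unfold Tavg; ring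
  rw [Finset.sum_add_distrib, Finset.sum_add_distrib, ← Finset.mul_sum,
    Finset.sum_sub_distrib, ← hT] at hs
  simp at hs
  rw [div_le_iff₀ (by norm_num)]
  nlinarith

lemma exp_moment [MeasurableSpace Ω] {P : Measure Ω} [IsProbabilityMeasure P]
    {ι : ℕ → Ω → Fin 6} (hι : IsIIDUniform P ι) (z0 : ℝ)
    {h : ℝ → ℝ} (hh : Measurable h) {H l : ℝ} (hH : ∀ x, |h x| ≤ H) (hl : 0 ≤ l)
    (hlH : 2 * l * H ≤ 1) (N : ℕ) :
    ∫⁻ ω, ENNReal.ofReal (Real.exp (l * Smart h ι z0 N ω)) ∂P ≤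
      ENNReal.ofReal (1 + 4 * l^2 * H^2) ^ N := by
  induction N with
  | zero => simp [Smart]
  | succ N ih =>
    have hS := Smart_meas hh ι z0 N
    have hZ := chain_meas ι z0 N
    let Y : Fin 6 → Ω → ENNReal := fun i ω =>
      ENNReal.ofReal (Real.exp (l * Smart h ι z0 N ω) *
        Real.exp (l * (h (zfun i (flatChain ι z0 N ω)) - Tavg h (flatChain ι z0 N ω))))
    have hY : ∀ i, Measurable[histM ι N] (Y i) := by
      intro i
      have hg : Measurable (fun p : ℝ × ℝ => ENNReal.ofReal (Real.exp (l * p.1) *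
        Real.exp (l * (h (zfun i p.2) - Tavg h p.2)))) := by
        have := zfun_meas i
        have := Tavg_meas hh
        fun_prop
      exact meas_comp2 (m := histM ι N) hg hS hZ
    have e : ∀ ω, ENNReal.ofReal (Real.exp (l * Smart h ι z0 (N+1) ω)) = Y (ι (N+1) ω) ω := by
      intro ω
      simp only [Y]
      rw [← Real.exp_add, ← mul_add]
      simp only [Smart, Finset.sum_range_succ]
      rfl
    simp_rw [e]
    rw [step_lintegral hι N Y hY]
    have b : ∀ ω, ∑ i, Y i ω * (1/6) ≤ ENNReal.ofReal (Real.exp (l * Smart h ι z0 N ω)) *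
        ENNReal.ofReal (1 + 4 * l^2 * H^2) := by
      intro ω
      have h6 : (1/6 : ENNReal) = ENNReal.ofReal (1/6) := by
        rw [ENNReal.ofReal_div_of_pos (by norm_num)]; simp
      simp only [Y]
      rw [h6, ← Finset.sum_mul, ← ENNReal.ofReal_sum_of_nonneg (fun i _ => by positivity),
        ← ENNReal.ofReal_mul (Finset.sum_nonneg fun i _ => by positivity),
        ← ENNReal.ofReal_mul (by positivity), ← Finset.mul_sum]
      apply ENNReal.ofReal_le_ofReal
      rw [mul_assoc]
      refine mul_le_mul_of_nonneg_left ?_ (by positivity)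
      have := exp_avg hH hl hlH (flatChain ι z0 N ω)
      linarith
    calc _ ≤ ∫⁻ ω, ENNReal.ofReal (Real.exp (l * Smart h ι z0 N ω)) *
        ENNReal.ofReal (1 + 4 * l^2 * H^2) ∂P := lintegral_mono b
      _ = (∫⁻ ω, ENNReal.ofReal (Real.exp (l * Smart h ι z0 N ω)) ∂P) *
        ENNReal.ofReal (1 + 4 * l^2 * H^2) := lintegral_mul_const' _ _ (by simp)
      _ ≤ _ := by rw [pow_succ]; exact mul_le_mul' ih le_rfl

lemma Smart_lln [MeasurableSpace Ω] {P : Measure Ω} [IsProbabilityMeasure P]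
    {ι : ℕ → Ω → Fin 6} (hι : IsIIDUniform P ι) (z0 : ℝ)
    {h : ℝ → ℝ} (hh : Measurable h) {H δ : ℝ} (hH : ∀ x, |h x| ≤ H) (hH1 : 1 ≤ H)
    (hδ : 0 < δ) (hδ1 : δ ≤ 1) :
    ∀ᵐ ω ∂P, ∀ᶠ N : ℕ in atTop, Smart h ι z0 N ω ≤ δ * N := by
  obtain ⟨l, hl⟩ : ∃ l, l = δ / (8 * H^2) := ⟨_, rfl⟩
  have hl0 : 0 < l := by rw [hl]; positivity
  have hl1 : l * (8 * H^2) = δ := by rw [hl]; field_simp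
  have hl2 : 2 * l * H ≤ 1 := by nlinarith
  have hl3 : 1 + 4 * l^2 * H^2 ≤ Real.exp (l * δ / 2) := by
    have := Real.add_one_le_exp (l * δ / 2)
    have e : 4 * l^2 * H^2 = l * δ / 2 := by rw [← hl1]; ring
    linarith
  have hdec : ∀ N : ℕ, ∫⁻ ω, ENNReal.ofReal (Real.exp (l * (Smart h ι z0 N ω - δ * N))) ∂P ≤
      ENNReal.ofReal (Real.exp (-(l * δ / 2))) ^ N := by
    intro N
    have e : ∀ ω, ENNReal.ofReal (Real.exp (l * (Smart h ι z0 N ω - δ * N))) =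
        ENNReal.ofReal (Real.exp (l * Smart h ι z0 N ω)) *
          ENNReal.ofReal (Real.exp (-(l * δ)) ^ N) := by
      intro ω
      rw [← ENNReal.ofReal_mul (by positivity), ← Real.exp_nat_mul, ← Real.exp_add]
      congr 2; ring
    simp_rw [e]
    rw [lintegral_mul_const' _ _ (by simp)]
    calc _ ≤ ENNReal.ofReal (1 + 4 * l^2 * H^2) ^ N * ENNReal.ofReal (Real.exp (-(l * δ)) ^ N) := by
          gcongr; exact exp_moment hι z0 hh hH hl0.le hl2 N
      _ ≤ ENNReal.ofReal (Real.exp (l * δ / 2)) ^ N * ENNReal.ofReal (Real.exp (-(l * δ)) ^ N) := by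
          gcongr
      _ = _ := by
          rw [ENNReal.ofReal_pow (by positivity), ← mul_pow, ← ENNReal.ofReal_mul (by positivity),
            ← Real.exp_add]
          congr 3; ring
  have hmeas : ∀ N : ℕ,
      Measurable fun ω => ENNReal.ofReal (Real.exp (l * (Smart h ι z0 N ω - δ * N))) := by
    intro N
    have := (Smart_meas hh ι z0 N).mono (histM_le hι.1 N) le_rfl
    fun_prop
  have hfin : ∫⁻ ω, ∑' N : ℕ, ENNReal.ofReal (Real.exp (l * (Smart h ι z0 N ω - δ * N))) ∂P ≠ ⊤ := by
    rw [lintegral_tsum fun N => (hmeas N).aemeasurable]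
    refine ne_top_of_le_ne_top ?_ (ENNReal.tsum_le_tsum hdec)
    rw [ENNReal.tsum_geometric, ENNReal.inv_ne_top]
    have : ENNReal.ofReal (Real.exp (-(l * δ / 2))) < 1 := by
      rw [ENNReal.ofReal_lt_one, Real.exp_lt_one_iff]
      have := mul_pos hl0 hδ
      linarith
    exact (tsub_pos_of_lt this).ne'
  filter_upwards [ae_lt_top (Measurable.tsum hmeas) hfin] with ω hω
  have ht := ENNReal.tendsto_atTop_zero_of_tsum_ne_top hω.ne
  filter_upwards [ht.eventually (gt_mem_nhds one_pos)] with N hN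
  rw [ENNReal.ofReal_lt_one, Real.exp_lt_one_iff] at hN
  by_contra hc
  push Not at hc
  have := mul_pos hl0 (sub_pos.2 hc)
  linarith

lemma Smart_eq (h : ℝ → ℝ) (ι : ℕ → Ω → Fin 6) (z0 : ℝ) (N : ℕ) (ω : Ω) :
    ∑ n ∈ Finset.range N, (h (flatChain ι z0 n ω) - Tavg h (flatChain ι z0 n ω)) =
      Smart h ι z0 N ω + h z0 - h (flatChain ι z0 N ω) := by
  have := Finset.sum_range_sub (fun n => h (flatChain ι z0 n ω)) N
  simp only [Smart, Finset.sum_sub_distrib] at *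
  have e : flatChain ι z0 0 ω = z0 := rfl
  rw [e] at this
  linarith

lemma Tavg_sum (G : ℕ → ℝ → ℝ) (K : ℕ) (x : ℝ) :
    Tavg (fun y => ∑ k ∈ Finset.range K, G k y) x = ∑ k ∈ Finset.range K, Tavg (G k) x := by
  unfold Tavg
  rw [Finset.sum_comm, Finset.sum_div]

lemma upper_bdd {μ : Measure ℝ} [IsProbabilityMeasure μ] (hμI : μ Iset = 1)
    (hinv : MInvariant μ) [MeasurableSpace Ω] {P : Measure Ω} [IsProbabilityMeasure P]
    {ι : ℕ → Ω → Fin 6} (hι : IsIIDUniform P ι) {z0 : ℝ} (hz : z0 ∈ Iset)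
    {G : ℝ → ℝ} {B : ℝ} (hG : Measurable G) (hB : ∀ x, |G x| ≤ B)
    (hc : ContinuousOn G Iset) {ε : ℝ} (hε : 0 < ε) (hε1 : ε ≤ 1) :
    ∀ᵐ ω ∂P, ∀ᶠ N : ℕ in atTop,
      (∑ n ∈ Finset.range (N+1), G (flatChain ι z0 n ω)) / ((N : ℝ) + 1) ≤
        ∫ x, G x ∂μ + 3 * ε := by
  obtain ⟨K, hK⟩ := iter_conv hμI hinv hG hB hc hε
  have hB0 : 0 ≤ B := (abs_nonneg _).trans (hB 0)
  let h : ℝ → ℝ := fun y => ∑ k ∈ Finset.range K, Tavg^[k] G y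
  have hh : Measurable h := Finset.measurable_sum _ fun k _ => iter_meas hG k
  have hH : ∀ x, |h x| ≤ K * B + 1 := by
    intro x
    refine (Finset.abs_sum_le_sum_abs _ _).trans ?_
    refine (Finset.sum_le_sum fun k _ => iter_bdd hB k x).trans ?_
    simp
  have hpo : ∀ x, h x - Tavg h x = G x - Tavg^[K] G x := by
    intro x
    have e : Tavg h x = ∑ k ∈ Finset.range K, Tavg^[k+1] G x := by
      simp only [Function.iterate_succ_apply']
      exact Tavg_sum _ K x
    rw [e]
    simp only [h]
    rw [← Finset.sum_sub_distrib]
    exact Finset.sum_range_sub' (fun k => Tavg^[k] G x) K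
  have hH1 : 1 ≤ K * B + 1 := by
    have : 0 ≤ K * B := by positivity
    linarith
  have hlarge : ∀ᶠ N : ℕ in atTop, 2 * (K * B + 1) ≤ ε * N :=
    ((tendsto_natCast_atTop_atTop (R := ℝ)).const_mul_atTop hε).eventually_ge_atTop _
  filter_upwards [Smart_lln hι z0 hh hH hH1 hε hε1] with ω hω
  have key : ∀ᶠ M : ℕ in atTop,
      (∑ n ∈ Finset.range M, G (flatChain ι z0 n ω)) ≤ (∫ x, G x ∂μ + 3 * ε) * M := by
    filter_upwards [hω, hlarge] with M h1 h2
    have h3 := Smart_eq h ι z0 M ω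
    simp only [hpo] at h3
    rw [Finset.sum_sub_distrib] at h3
    have h4 : ∑ n ∈ Finset.range M, Tavg^[K] G (flatChain ι z0 n ω) ≤
        M * (∫ x, G x ∂μ + ε) := by
      refine (Finset.sum_le_sum fun n _ => hK _ (chain_mem ι hz n ω)).trans ?_
      simp [mul_add]
    have h5 := (abs_le.1 (hH z0)).2
    have h6 := (abs_le.1 (hH (flatChain ι z0 M ω))).1
    nlinarith
  filter_upwards [(tendsto_add_atTop_nat 1).eventually key] with N hN
  rw [div_le_iff₀ (by positivity)]
  push_cast at hN
  exact hN

lemma upper_cont {μ : Measure ℝ} [IsProbabilityMeasure μ] (hμI : μ Iset = 1)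
    (hinv : MInvariant μ) [MeasurableSpace Ω] {P : Measure Ω} [IsProbabilityMeasure P]
    {ι : ℕ → Ω → Fin 6} (hι : IsIIDUniform P ι) {z0 : ℝ} (hz : z0 ∈ Iset)
    {f : ℝ → ℝ} (hc : ContinuousOn f Iset) {ε : ℝ} (hε : 0 < ε) (hε1 : ε ≤ 1) :
    ∀ᵐ ω ∂P, ∀ᶠ N : ℕ in atTop,
      (∑ n ∈ Finset.range (N+1), f (flatChain ι z0 n ω)) / ((N : ℝ) + 1) ≤
        ∫ x, f x ∂μ + 3 * ε := by
  have h01 : (0:ℝ) ≤ 1/2 := by norm_num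
  let G : ℝ → ℝ := Set.IccExtend h01 (Set.domRestrict (Set.Icc (0:ℝ) (1/2)) f)
  have hGc : Continuous G := hc.domRestrict.Icc_extend'
  have hGf : ∀ x ∈ Iset, G x = f x := fun x hx => Set.IccExtend_of_mem h01 _ hx
  obtain ⟨B, hB⟩ := (isCompact_Icc (a := (0:ℝ)) (b := 1/2)).exists_bound_of_continuousOn hc
  have hGB : ∀ x, |G x| ≤ B := fun x => hB _ (Set.projIcc 0 (1/2) h01 x).2
  have hae : ∀ᵐ y ∂μ, y ∈ Iset := by
    have hm : MeasurableSet Iset := measurableSet_Icc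
    exact (prob_compl_eq_zero_iff hm).2 hμI
  have hint : ∫ x, f x ∂μ = ∫ x, G x ∂μ :=
    integral_congr_ae (hae.mono fun x hx => (hGf x hx).symm)
  have := upper_bdd hμI hinv hι hz hGc.measurable hGB hGc.continuousOn hε hε1
  rw [hint]
  filter_upwards [this] with ω hω
  filter_upwards [hω] with N hN
  refine le_of_eq_of_le ?_ hN
  congr 1
  exact Finset.sum_congr rfl fun n _ => (hGf _ (chain_mem ι hz n ω)).symm

/-- **Strong law of large numbers for the flat chain.** If `μ` is an `M`-invariant
probability measure on `[0,1/2]` then, for any starting point `z₀ ∈ [0,1/2]` and any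
continuous `f : [0,1/2] → ℝ`, almost surely the time averages of `f` along the flat chain
converge to `∫ f dμ`. -/
theorem flat_chain_strong_law
    (μ : Measure ℝ) (hμ : IsProbabilityMeasure μ)
    (hμI : μ (Set.Icc (0:ℝ) (1/2)) = 1) (hinv : MInvariant μ)
    [MeasurableSpace Ω] (P : Measure Ω) [IsProbabilityMeasure P]
    (ι : ℕ → Ω → Fin 6) (hι : IsIIDUniform P ι)
    (z0 : ℝ) (hz0 : z0 ∈ Set.Icc (0:ℝ) (1/2)) :
    ∀ f : ℝ → ℝ, ContinuousOn f (Set.Icc (0:ℝ) (1/2)) →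
      ∀ᵐ ω ∂P,
        Tendsto
          (fun N : ℕ =>
            (∑ n ∈ Finset.range (N+1), f (flatChain ι z0 n ω)) / ((N : ℝ) + 1))
          atTop (nhds (∫ x, f x ∂μ)) := by
  intro f hf
  have hpos : ∀ k : ℕ, (0:ℝ) < 1 / ((k:ℝ) + 1) := fun k => by positivity
  have hle : ∀ k : ℕ, 1 / ((k:ℝ) + 1) ≤ 1 := fun k => by
    rw [div_le_one (by positivity)]; linarith [Nat.cast_nonneg (α := ℝ) k]
  have hup := ae_all_iff.2 fun k : ℕ => upper_cont hμI hinv hι hz0 hf (hpos k) (hle k)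
  have hlo := ae_all_iff.2 fun k : ℕ => upper_cont hμI hinv hι hz0 hf.neg (hpos k) (hle k)
  filter_upwards [hup, hlo] with ω h1 h2
  rw [Metric.tendsto_nhds]
  intro ε hε
  obtain ⟨k, hk⟩ := exists_nat_one_div_lt (show 0 < ε / 3 by positivity)
  filter_upwards [h1 k, h2 k] with N a b
  simp only [Pi.neg_apply, Finset.sum_neg_distrib, integral_neg, neg_div] at b
  rw [Real.dist_eq, abs_lt]
  constructor <;> linarith

end
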